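/- Let q be an odd prime power with q ≡ 2 (mod 3), and let 4 ≤ k ≤ q. Let g_i(X) = X^3 and f_i(X) = X^{i−1} for each 3 ≤ i ≤ k+1, and let S(k+1,q) = S(k+1,q; f_3,g_3,…,f_{k+1},g_{k+1}) and S(k,q) = S(k,q; f_3,g_3,…,f_k,g_k). If k < ((q−1)/q)·M_q + 2, then λ_2(S(k+1,q)) = λ_2(S(k,q)). -/

import Mathlib

/-- The exponential sum `ε_f = Σ_{x ∈ F_q} ζ_p^{Tr(f(x))}` of a polynomial `f` over `F_q`,
where `ζ_p = exp(2πi/p)` and `Tr : F_q → F_p` is the absolute trace. -/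
noncomputable def expSum (p : ℕ) (F : Type) [Field F] [Fintype F] [Algebra (ZMod p) F]
    (f : Polynomial F) : ℂ :=
  ∑ x : F, Complex.exp (2 * Real.pi * Complex.I / p) ^ (Algebra.trace (ZMod p) F (f.eval x)).val

/-- The list of eigenvalues (with multiplicity) of a Hermitian real matrix,
sorted in increasing order. -/
noncomputable def eigSorted {V : Type} [Fintype V] [DecidableEq V] {A : Matrix V V ℝ}
    (hA : A.IsHermitian) : List ℝ :=
  (Finset.univ.val.map hA.eigenvalues).sort (· ≤ ·)

/-- The second largest eigenvalue (with multiplicity) of a Hermitian real matrix on at least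
two indices: the entry at position `card V - 2` of the increasingly sorted list of its
`card V` eigenvalues. -/
noncomputable def secondLargestEig {V : Type} [Fintype V] [DecidableEq V] {A : Matrix V V ℝ}
    (hA : A.IsHermitian) : ℝ :=
  (eigSorted hA).getD (Fintype.card V - 2) 0

theorem sort_getD_card_sub_two {a μ : ℝ} {t : Multiset ℝ} (hμ : μ ∈ t)
    (hle : ∀ x ∈ t, x ≤ μ) (ha : μ ≤ a) :
    ((a ::ₘ t).sort (· ≤ ·)).getD (Multiset.card (a ::ₘ t) - 2) 0 = μ := by
  obtain ⟨r, rfl⟩ := Multiset.exists_cons_of_mem hμ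
  have hsort : (a ::ₘ μ ::ₘ r).sort (· ≤ ·) = r.sort (· ≤ ·) ++ [μ, a] := by
    apply List.Perm.eq_of_pairwise' (r := (· ≤ ·)) (Multiset.pairwise_sort _ _)
    · rw [List.pairwise_append]
      refine ⟨Multiset.pairwise_sort _ _, by simpa using ha, fun x hx y hy => ?_⟩
      have hx' : x ≤ μ := hle x (Multiset.mem_cons_of_mem ((Multiset.mem_sort _).1 hx))
      simp only [List.mem_cons, List.not_mem_nil, or_false] at hy
      rcases hy with rfl | rfl
      · exact hx'
      · exact hx'.trans ha
    · rw [← Multiset.coe_eq_coe, Multiset.sort_eq, ← Multiset.coe_add, Multiset.sort_eq]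
      rw [← Multiset.cons_coe, ← Multiset.cons_coe, Multiset.coe_nil, Multiset.add_cons,
        Multiset.add_cons, add_zero, Multiset.cons_swap]
  rw [hsort, List.getD_append_right _ _ _ _ (by simp)]
  simp

/-- A Hermitian real matrix that is diagonalised over `ℂ` by an invertible matrix has the real
parts of the diagonal entries as its eigenvalues. -/
theorem eigenvalues_eq_of_diagonalization {V : Type} [Fintype V] [DecidableEq V]
    {A : Matrix V V ℝ} (hA : A.IsHermitian) {U W : Matrix V V ℂ} {d : V → ℂ}
    (hUW : U * W = 1) (hAU : A.map Complex.ofRealHom * U = U * Matrix.diagonal d) :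
    Finset.univ.val.map hA.eigenvalues = Finset.univ.val.map fun w => (d w).re := by
  have hWU : W * U = 1 := mul_eq_one_comm.1 hUW
  have hchar : (A.map Complex.ofRealHom).charpoly = (Matrix.diagonal d).charpoly := by
    rw [← mul_one (A.map Complex.ofRealHom), ← hUW, ← mul_assoc, hAU, mul_assoc,
      Matrix.charpoly_mul_comm, mul_assoc, hWU, mul_one]
  have hroots := congrArg (fun P => P.roots.map Complex.re) hchar
  rw [Matrix.charpoly_map, hA.charpoly_eq, Matrix.charpoly_diagonal, Polynomial.map_prod] at hroots
  have hr (v : V → ℂ) : (∏ i, (Polynomial.X - Polynomial.C (v i))).roots =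
      Finset.univ.val.map v := by
    rw [Polynomial.roots_prod _ _
      (by simp [Finset.prod_ne_zero_iff, Polynomial.X_sub_C_ne_zero])]
    simp
  simp only [Polynomial.map_sub, Polynomial.map_X, Polynomial.map_C] at hroots
  rw [hr, hr, Multiset.map_map, Multiset.map_map] at hroots
  simpa [Function.comp_def] using hroots

theorem secondLargestEig_eq_of_diagonalization {V : Type} [Fintype V] [DecidableEq V]
    {A : Matrix V V ℝ} (hA : A.IsHermitian) {U W : Matrix V V ℂ} {d : V → ℂ}
    (hUW : U * W = 1) (hAU : A.map Complex.ofRealHom * U = U * Matrix.diagonal d)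
    {μ : ℝ} (v w : V) (hvw : w ≠ v) (hw : (d w).re = μ) (hv : μ ≤ (d v).re)
    (hle : ∀ x, x ≠ v → (d x).re ≤ μ) : secondLargestEig hA = μ := by
  have hsplit : Finset.univ.val.map hA.eigenvalues =
      (d v).re ::ₘ (Finset.univ.erase v).val.map fun x => (d x).re := by
    rw [eigenvalues_eq_of_diagonalization hA hUW hAU, Finset.erase_val,
      ← Multiset.map_cons (fun x => (d x).re),
      Multiset.cons_erase (Finset.mem_univ_val v)]
  have hcard : Fintype.card V =
      Multiset.card ((d v).re ::ₘ (Finset.univ.erase v).val.map fun x => (d x).re) := by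
    rw [← hsplit, Multiset.card_map]
    rfl
  rw [secondLargestEig, eigSorted, hcard, hsplit]
  refine sort_getD_card_sub_two ?_ ?_ hv
  · exact Multiset.mem_map.2 ⟨w, Finset.mem_erase.2 ⟨hvw, Finset.mem_univ w⟩, hw⟩
  · intro x hx
    obtain ⟨y, hy, rfl⟩ := Multiset.mem_map.1 hx
    exact hle y (Finset.ne_of_mem_erase hy)

/-- The canonical additive character `x ↦ ζ_p ^ Tr(x)` of a finite field. -/
noncomputable def traceChar (p : ℕ) [NeZero p] (F : Type) [Field F] [Algebra (ZMod p) F] :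
    AddChar F ℂ :=
  (ZMod.stdAddChar (N := p)).compAddMonoidHom (Algebra.trace (ZMod p) F).toAddMonoidHom

theorem traceChar_apply (p : ℕ) [NeZero p] (F : Type) [Field F] [Algebra (ZMod p) F] (x : F) :
    traceChar p F x =
      Complex.exp (2 * Real.pi * Complex.I / p) ^ (Algebra.trace (ZMod p) F x).val := by
  have h := ZMod.stdAddChar_coe (N := p) ((Algebra.trace (ZMod p) F x).val : ℤ)
  rw [Int.cast_natCast, ZMod.natCast_zmod_val] at h
  change ZMod.stdAddChar (Algebra.trace (ZMod p) F x) = _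
  rw [h, ← Complex.exp_nat_mul]
  congr 1
  push_cast
  ring

theorem traceChar_isPrimitive (p : ℕ) [Fact p.Prime] (F : Type) [Field F] [Finite F]
    [Algebra (ZMod p) F] : (traceChar p F).IsPrimitive := by
  apply AddChar.IsPrimitive.of_ne_one
  have : Module.Finite (ZMod p) F := Module.Finite.of_finite
  obtain ⟨x, hx⟩ := Algebra.trace_surjective (ZMod p) F 1
  rw [AddChar.ne_one_iff]
  refine ⟨x, fun h => ?_⟩
  change ZMod.stdAddChar (Algebra.trace (ZMod p) F x) = 1 at h
  rw [hx, ← (ZMod.stdAddChar (N := p)).map_zero_eq_one] at h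
  exact one_ne_zero (ZMod.injective_stdAddChar h)

section

variable {F : Type} [Field F] {m : ℕ}

/-- The difference `b - a` of adjacent vertices with `b₁ - a₁ = t` and `b₂ - a₂ = t u`. -/
def step (m : ℕ) (t u : F) : Fin (m + 2) → F :=
  Fin.cons t (Fin.cons (t * u) fun i : Fin m => t ^ 3 * u ^ ((i : ℕ) + 2))

/-- The coefficients `w₂, …` of a character as a polynomial, with the factor `X²` removed. -/
noncomputable def tailPoly (w : Fin (m + 2) → F) : Polynomial F :=
  ∑ i : Fin m, Polynomial.C (w i.succ.succ) * Polynomial.X ^ (i : ℕ)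

theorem dotProduct_step (w : Fin (m + 2) → F) (t u : F) :
    w ⬝ᵥ step m t u = u ^ 2 * (tailPoly w).eval u * t ^ 3 + (w 0 + w 1 * u) * t := by
  have h : ∑ i : Fin m, w i.succ.succ * (t ^ 3 * u ^ ((i : ℕ) + 2)) =
      u ^ 2 * (tailPoly w).eval u * t ^ 3 := by
    rw [tailPoly, Polynomial.eval_finsetSum, Finset.mul_sum, Finset.sum_mul]
    refine Finset.sum_congr rfl fun i _ => ?_
    simp only [Polynomial.eval_mul, Polynomial.eval_C, Polynomial.eval_pow, Polynomial.eval_X]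
    ring
  rw [dotProduct, Fin.sum_univ_succ, Fin.sum_univ_succ]
  simp only [step, Fin.cons_zero, Fin.cons_succ, h]
  rw [Fin.succ_zero_eq_one]
  ring

theorem tailPoly_ne_zero {w : Fin (m + 2) → F} (hw : w ≠ 0) (h0 : w 0 = 0) (h1 : w 1 = 0) :
    tailPoly w ≠ 0 := by
  intro h
  apply hw
  funext i
  refine Fin.cases h0 (fun i => Fin.cases h1 (fun j => ?_) i) i
  have hc := congrArg (fun P => Polynomial.coeff P (j : ℕ)) h
  simpa [tailPoly, Polynomial.finsetSum_coeff, Polynomial.coeff_C_mul, Polynomial.coeff_X_pow,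
    Fin.val_inj] using hc

theorem natDegree_tailPoly_le (w : Fin (m + 2) → F) : (tailPoly w).natDegree ≤ m - 1 := by
  refine Polynomial.natDegree_sum_le_of_forall_le _ _ fun i _ => ?_
  refine (Polynomial.natDegree_C_mul_X_pow_le _ _).trans ?_
  omega

/-- The character `x ↦ ψ (x₂ + c x₄)`, in one-based coordinates. -/
def extremalVector (m : ℕ) (c : F) : Fin (m + 2) → F :=
  Fin.cons 0 (Fin.cons 1 fun i : Fin m => if (i : ℕ) = 1 then c else 0)

/-- Adjacency in the graph is translation by a step. -/
theorem adj_iff_exists_step {a b : Fin (m + 2) → F} :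
    (a 0 ≠ b 0 ∧ ∀ i : Fin (m + 2), 2 ≤ (i : ℕ) →
        b i - a i = (b 0 - a 0) ^ 3 * ((b 1 - a 1) / (b 0 - a 0)) ^ (i : ℕ)) ↔
      b 0 - a 0 ≠ 0 ∧ b = a + step m (b 0 - a 0) ((b 1 - a 1) / (b 0 - a 0)) := by
  rw [sub_ne_zero, ne_comm, and_congr_right_iff]
  intro h
  have h' : b 0 - a 0 ≠ 0 := sub_ne_zero.2 h
  constructor
  · intro hi
    funext i
    refine Fin.cases ?_ (fun i => Fin.cases ?_ (fun j => ?_) i) i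
    · simp [step]
    · simp [step, mul_div_cancel₀ _ h']
    · have := hi j.succ.succ (by simp)
      simp only [Fin.val_succ] at this
      simp only [Pi.add_apply, step, Fin.cons_succ]
      linear_combination this
  · intro hb i hi
    obtain ⟨j, rfl⟩ : ∃ j : Fin m, i = j.succ.succ :=
      ⟨⟨i - 2, by omega⟩, Fin.ext (by simp; omega)⟩
    have := congrFun hb j.succ.succ
    simp only [Pi.add_apply, step, Fin.cons_succ] at this
    simp only [Fin.val_succ]
    linear_combination this

variable [Fintype F]

/-- The exponential sum of `aX³ + bX` with respect to an additive character. -/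
noncomputable def cubicSum (ψ : AddChar F ℂ) (a b : F) : ℂ :=
  ∑ t : F, ψ (a * t ^ 3 + b * t)

theorem expSum_eq_cubicSum (p : ℕ) [NeZero p] [Algebra (ZMod p) F] (a b : F) :
    expSum p F (Polynomial.C a * Polynomial.X ^ 3 + Polynomial.C b * Polynomial.X) =
      cubicSum (traceChar p F) a b := by
  simp [expSum, cubicSum, traceChar_apply]

theorem cubicSum_re_eq (ψ : AddChar F ℂ) (a b : F) :
    (((cubicSum ψ a b).re : ℝ) : ℂ) = cubicSum ψ a b := by
  rw [← Complex.conj_eq_iff_re, cubicSum, map_sum]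
  refine Fintype.sum_equiv (Equiv.neg F) _ _ fun t => ?_
  rw [← AddChar.map_neg_eq_conj]
  congr 1
  simp only [Equiv.neg_apply]
  ring

theorem cubicSum_re_le (ψ : AddChar F ℂ) (a b : F) :
    (cubicSum ψ a b).re ≤ Fintype.card F := by
  refine (Complex.re_le_norm _).trans ((norm_sum_le _ _).trans ?_)
  simp [AddChar.norm_apply]

theorem cubicSum_zero_zero (ψ : AddChar F ℂ) : cubicSum ψ 0 0 = Fintype.card F := by
  simp [cubicSum]

theorem cubicSum_zero_left {ψ : AddChar F ℂ} (hψ : ψ.IsPrimitive) {b : F} (hb : b ≠ 0) :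
    cubicSum ψ 0 b = 0 := by
  classical
  simpa [cubicSum, hb, mul_comm] using AddChar.sum_mulShift b hψ

theorem cube_injective (hF : Fintype.card F % 3 = 2) : Function.Injective fun x : F => x ^ 3 := by
  set j := Fintype.card F / 3
  have hj : Fintype.card F = 3 * j + 2 := by omega
  have hinv (x : F) : (x ^ 3) ^ (2 * j + 1) = x := by
    have hx : x ^ (3 * j + 2) = x := hj ▸ FiniteField.pow_card x
    calc (x ^ 3) ^ (2 * j + 1) = x ^ (3 * j + 2) * x ^ (3 * j + 1) := by ring
      _ = x ^ (3 * j + 2) := by rw [hx, ← pow_succ', hx]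
      _ = x := hx
  intro x y hxy
  rw [← hinv x, ← hinv y]
  exact congrArg (· ^ (2 * j + 1)) hxy

theorem cubicSum_zero_right {ψ : AddChar F ℂ} (hψ : ψ.IsPrimitive)
    (hF : Fintype.card F % 3 = 2) {a : F} (ha : a ≠ 0) : cubicSum ψ a 0 = 0 := by
  classical
  have hbij := Finite.injective_iff_bijective.1 (cube_injective hF)
  have h := (Equiv.ofBijective _ hbij).sum_comp fun t => ψ (t * a)
  rw [AddChar.sum_mulShift a hψ, if_neg ha] at h
  simpa [cubicSum, mul_comm] using h

theorem cubicSum_scale (ψ : AddChar F ℂ) (a b : F) {c : F} (hc : c ≠ 0) :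
    cubicSum ψ (a * c ^ 3) (b * c) = cubicSum ψ a b := by
  refine Fintype.sum_equiv (Equiv.mulLeft₀ c hc) _ _ fun t => ?_
  congr 1
  simp only [Equiv.mulLeft₀_apply]
  ring

/-- The eigenvalue of the graph at the character `x ↦ ψ (w ⬝ x)`. -/
noncomputable def eigenvalueAt (ψ : AddChar F ℂ) (w : Fin (m + 2) → F) : ℂ :=
  ∑ u : F, cubicSum ψ (u ^ 2 * (tailPoly w).eval u) (w 0 + w 1 * u) - Fintype.card F

theorem eigenvalueAt_eq_sum [DecidableEq F] (ψ : AddChar F ℂ) (w : Fin (m + 2) → F) :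
    eigenvalueAt ψ w = ∑ x : F × F with x.1 ≠ 0, ψ (w ⬝ᵥ step m x.1 x.2) := by
  rw [Finset.sum_filter, Fintype.sum_prod_type_right, eigenvalueAt]
  simp_rw [dotProduct_step]
  have h (u : F) : ∑ t : F, (if t ≠ 0 then
      ψ (u ^ 2 * (tailPoly w).eval u * t ^ 3 + (w 0 + w 1 * u) * t) else 0) =
      cubicSum ψ (u ^ 2 * (tailPoly w).eval u) (w 0 + w 1 * u) - 1 := by
    rw [cubicSum, ← Finset.add_sum_erase _ _ (Finset.mem_univ (0 : F)),
      ← Finset.add_sum_erase _ (fun t => ψ _) (Finset.mem_univ (0 : F))]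
    simp only [ne_eq, not_true_eq_false, if_false, zero_add]
    rw [show (u ^ 2 * (tailPoly w).eval u * 0 ^ 3 + (w 0 + w 1 * u) * 0) = 0 by ring,
      AddChar.map_zero_eq_one, add_sub_cancel_left]
    exact Finset.sum_congr rfl fun t ht => if_pos (Finset.ne_of_mem_erase ht)
  simp_rw [h]
  simp

theorem eigenvalueAt_re (ψ : AddChar F ℂ) (w : Fin (m + 2) → F) :
    (eigenvalueAt ψ w).re =
      ∑ u : F, (cubicSum ψ (u ^ 2 * (tailPoly w).eval u) (w 0 + w 1 * u)).re -
        Fintype.card F := by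
  simp [eigenvalueAt]

theorem eigenvalueAt_zero_re (ψ : AddChar F ℂ) :
    (eigenvalueAt ψ (0 : Fin (m + 2) → F)).re =
      ((Fintype.card F : ℝ) - 1) * Fintype.card F := by
  rw [eigenvalueAt_re]
  simp [tailPoly, cubicSum_zero_zero]
  ring

/-- Eigenvalues at characters whose first two coordinates vanish. -/
theorem eigenvalueAt_re_le_of_head_eq_zero {ψ : AddChar F ℂ} (hψ : ψ.IsPrimitive)
    (hF : Fintype.card F % 3 = 2) (hm : 1 ≤ m) {w : Fin (m + 2) → F} (hw : w ≠ 0)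
    (h0 : w 0 = 0) (h1 : w 1 = 0) :
    (eigenvalueAt ψ w).re ≤ ((m : ℝ) - 1) * Fintype.card F := by
  classical
  set R := tailPoly w with hR
  have hR0 : R ≠ 0 := tailPoly_ne_zero hw h0 h1
  set Z : Finset F := insert 0 R.roots.toFinset
  have hZ : Z.card ≤ m := by
    have h1 := Finset.card_insert_le (0 : F) R.roots.toFinset
    have h2 := R.roots.toFinset_card_le
    have h3 := R.card_roots'
    have h4 := natDegree_tailPoly_le w
    rw [← hR] at h4
    change Z.card ≤ _ at h1
    omega
  have hterm (u : F) : (cubicSum ψ (u ^ 2 * R.eval u) (w 0 + w 1 * u)).re ≤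
      if u ∈ Z then (Fintype.card F : ℝ) else 0 := by
    split_ifs with hu
    · exact cubicSum_re_le _ _ _
    · have hu' : u ≠ 0 ∧ R.eval u ≠ 0 := by
        simpa [Z, hR0] using hu
      rw [h0, h1, zero_mul, add_zero, cubicSum_zero_right hψ hF
        (mul_ne_zero (pow_ne_zero 2 hu'.1) hu'.2), Complex.zero_re]
  rw [eigenvalueAt_re]
  have hsum := Finset.sum_le_sum fun u (_ : u ∈ Finset.univ) => hterm u
  rw [Finset.sum_ite_mem, Finset.univ_inter, Finset.sum_const, nsmul_eq_mul] at hsum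
  have hZ' : (Z.card : ℝ) ≤ m := by exact_mod_cast hZ
  nlinarith [mul_le_mul_of_nonneg_right hZ' (Nat.cast_nonneg' (Fintype.card F) : (0 : ℝ) ≤ _)]

/-- Eigenvalues at characters whose first two coordinates do not both vanish. -/
theorem eigenvalueAt_re_le_of_head_ne_zero {ψ : AddChar F ℂ} (hψ : ψ.IsPrimitive) {M : ℝ}
    (hM0 : 0 ≤ M) (hMF : M ≤ Fintype.card F)
    (hM : ∀ a b : F, a ≠ 0 → b ≠ 0 → (cubicSum ψ a b).re ≤ M) {w : Fin (m + 2) → F}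
    (hw : ¬(w 0 = 0 ∧ w 1 = 0)) :
    (eigenvalueAt ψ w).re ≤ ((Fintype.card F : ℝ) - 1) * M := by
  classical
  have hM' (a b : F) (hb : b ≠ 0) : (cubicSum ψ a b).re ≤ M := by
    rcases eq_or_ne a 0 with rfl | ha
    · simpa [cubicSum_zero_left hψ hb] using hM0
    · exact hM a b ha hb
  rw [eigenvalueAt_re]
  by_cases h1 : w 1 = 0
  · have h0 : w 0 ≠ 0 := fun h => hw ⟨h, h1⟩
    have hsum := Finset.sum_le_card_nsmul Finset.univ
      (fun u : F => (cubicSum ψ (u ^ 2 * (tailPoly w).eval u) (w 0 + w 1 * u)).re) M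
      fun u _ => hM' _ _ (by simpa [h1] using h0)
    rw [Finset.card_univ, nsmul_eq_mul] at hsum
    linarith
  · set r := -w 0 / w 1 with hr
    have hsum := Finset.sum_le_card_nsmul (Finset.univ.erase r)
      (fun u : F => (cubicSum ψ (u ^ 2 * (tailPoly w).eval u) (w 0 + w 1 * u)).re) M
      fun u hu => hM' _ _ fun h => Finset.ne_of_mem_erase hu (by
        rw [hr, eq_div_iff h1]
        linear_combination h)
    rw [Finset.card_erase_of_mem (Finset.mem_univ r), Finset.card_univ, nsmul_eq_mul,
      Nat.cast_sub Fintype.card_pos, Nat.cast_one] at hsum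
    rw [← Finset.add_sum_erase _ _ (Finset.mem_univ r)]
    linarith [cubicSum_re_le ψ (r ^ 2 * (tailPoly w).eval r) (w 0 + w 1 * r)]

theorem eigenvalueAt_extremalVector_re (ψ : AddChar F ℂ) (hm : 2 ≤ m) (a : F) {b : F}
    (hb : b ≠ 0) :
    (eigenvalueAt ψ (extremalVector m (a / b ^ 3))).re =
      ((Fintype.card F : ℝ) - 1) * (cubicSum ψ a b).re := by
  classical
  have heval (u : F) : (tailPoly (extremalVector m (a / b ^ 3))).eval u = a / b ^ 3 * u := by
    rw [tailPoly, Polynomial.eval_finsetSum, Finset.sum_eq_single ⟨1, hm⟩]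
    · have h3 : extremalVector m (a / b ^ 3) (Fin.succ (Fin.succ ⟨1, hm⟩)) = a / b ^ 3 := by
        simp only [extremalVector, Fin.cons_succ, if_true]
      simp only [h3, Polynomial.eval_mul, Polynomial.eval_C,
        Polynomial.eval_X, pow_one]
    · intro i _ hi
      have : (i : ℕ) ≠ 1 := fun h => hi (Fin.ext h)
      simp [extremalVector, this]
    · simp
  have h0 : extremalVector m (a / b ^ 3) 0 = 0 := rfl
  have h1 : extremalVector m (a / b ^ 3) 1 = 1 := rfl
  rw [eigenvalueAt_re, ← Finset.add_sum_erase _ _ (Finset.mem_univ (0 : F)),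
    Finset.sum_congr rfl (g := fun _ => (cubicSum ψ a b).re), Finset.sum_const,
    Finset.card_erase_of_mem (Finset.mem_univ 0), Finset.card_univ, nsmul_eq_mul,
    Nat.cast_sub Fintype.card_pos, Nat.cast_one]
  · simp [h0, cubicSum_zero_zero]
  · intro u hu
    have hu0 : u ≠ 0 := Finset.ne_of_mem_erase hu
    rw [heval, h0, h1, ← cubicSum_scale ψ a b (div_ne_zero hu0 hb)]
    congr 2 <;> field_simp
    ring

theorem sum_char_dotProduct [DecidableEq F] {ψ : AddChar F ℂ} (hψ : ψ.IsPrimitive) {n : ℕ}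
    (x : Fin n → F) :
    ∑ w : Fin n → F, ψ (w ⬝ᵥ x) = if x = 0 then (Fintype.card F : ℂ) ^ n else 0 := by
  have hprod : ∑ w : Fin n → F, ψ (w ⬝ᵥ x) = ∏ i, ∑ c : F, ψ (c * x i) := by
    rw [Finset.prod_univ_sum, Fintype.piFinset_univ]
    exact Finset.sum_congr rfl fun w _ =>
      map_prod ψ.toMonoidHom (fun i => Multiplicative.ofAdd (w i * x i)) Finset.univ
  rw [hprod]
  simp_rw [AddChar.sum_mulShift _ hψ]
  split_ifs with hx
  · simp [hx]
  · obtain ⟨i, hi⟩ := Function.ne_iff.1 hx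
    exact Finset.prod_eq_zero (Finset.mem_univ i) (by simpa using hi)

/-- The character table of the additive group `Fⁿ`. -/
noncomputable def charTable (ψ : AddChar F ℂ) (n : ℕ) : Matrix (Fin n → F) (Fin n → F) ℂ :=
  Matrix.of fun a w => ψ (w ⬝ᵥ a)

theorem charTable_mul_inv [DecidableEq F] {ψ : AddChar F ℂ} (hψ : ψ.IsPrimitive) (n : ℕ) :
    charTable ψ n *
      (((Fintype.card F : ℂ) ^ n)⁻¹ • Matrix.of fun w b : Fin n → F => ψ (-(w ⬝ᵥ b))) = 1 := by
  ext a b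
  have h : ∑ w : Fin n → F, ψ (w ⬝ᵥ a) * ψ (-(w ⬝ᵥ b)) =
      if a - b = 0 then (Fintype.card F : ℂ) ^ n else 0 := by
    rw [← sum_char_dotProduct hψ]
    refine Finset.sum_congr rfl fun w _ => ?_
    rw [← AddChar.map_add_eq_mul, dotProduct_sub, sub_eq_add_neg]
  rw [Matrix.mul_smul, Matrix.smul_apply, Matrix.mul_apply]
  simp only [charTable, Matrix.of_apply, h, sub_eq_zero, Matrix.one_apply, smul_eq_mul]
  split_ifs <;> simp

variable [DecidableEq F]

theorem adjMatrix_mul_charTable (ψ : AddChar F ℂ) (G : SimpleGraph (Fin (m + 2) → F))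
    [DecidableRel G.Adj]
    (hAdj : ∀ a b : Fin (m + 2) → F, G.Adj a b ↔
      (a 0 ≠ b 0 ∧ ∀ i : Fin (m + 2), 2 ≤ (i : ℕ) →
        b i - a i = (b 0 - a 0) ^ 3 * ((b 1 - a 1) / (b 0 - a 0)) ^ (i : ℕ))) :
    (G.adjMatrix ℝ).map Complex.ofRealHom * charTable ψ (m + 2) =
      charTable ψ (m + 2) * Matrix.diagonal (eigenvalueAt ψ) := by
  ext a w
  rw [Matrix.mul_diagonal, Matrix.mul_apply, eigenvalueAt_eq_sum, Finset.mul_sum]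
  simp only [Matrix.map_apply, SimpleGraph.adjMatrix_apply, charTable, Matrix.of_apply,
    Complex.ofRealHom_eq_coe, apply_ite Complex.ofReal, Complex.ofReal_one, Complex.ofReal_zero,
    ite_mul, one_mul, zero_mul]
  rw [← Finset.sum_filter]
  refine Finset.sum_bij' (fun b _ => (b 0 - a 0, (b 1 - a 1) / (b 0 - a 0)))
    (fun x _ => a + step m x.1 x.2) ?_ ?_ ?_ ?_ ?_
  · intro b hb
    simpa using ((hAdj a b).trans adj_iff_exists_step |>.1 (Finset.mem_filter.1 hb).2).1
  · intro x hx
    have hx0 : x.1 ≠ 0 := (Finset.mem_filter.1 hx).2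
    refine Finset.mem_filter.2 ⟨Finset.mem_univ _, (hAdj _ _).trans adj_iff_exists_step |>.2 ?_⟩
    have h1 : step m x.1 x.2 1 = x.1 * x.2 := rfl
    have h0 : step m x.1 x.2 0 = x.1 := rfl
    simp [h0, h1, hx0]
  · intro b hb
    exact ((hAdj a b).trans adj_iff_exists_step |>.1 (Finset.mem_filter.1 hb).2).2.symm
  · intro x hx
    have hx0 : x.1 ≠ 0 := (Finset.mem_filter.1 hx).2
    have h1 : step m x.1 x.2 1 = x.1 * x.2 := rfl
    have h0 : step m x.1 x.2 0 = x.1 := rfl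
    simp [h0, h1, hx0]
  · intro b hb
    rw [← AddChar.map_add_eq_mul, ← dotProduct_add,
      ← ((hAdj a b).trans adj_iff_exists_step |>.1 (Finset.mem_filter.1 hb).2).2]

/-- The second largest eigenvalue of the graph when `M` is the largest cubic exponential sum and
dominates the eigenvalues coming from roots of polynomials. -/
theorem secondLargestEig_eq_mul {ψ : AddChar F ℂ} (hψ : ψ.IsPrimitive)
    (hF : Fintype.card F % 3 = 2) (hm : 2 ≤ m) (G : SimpleGraph (Fin (m + 2) → F))
    [DecidableRel G.Adj]
    (hAdj : ∀ a b : Fin (m + 2) → F, G.Adj a b ↔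
      (a 0 ≠ b 0 ∧ ∀ i : Fin (m + 2), 2 ≤ (i : ℕ) →
        b i - a i = (b 0 - a 0) ^ 3 * ((b 1 - a 1) / (b 0 - a 0)) ^ (i : ℕ)))
    (hA : (G.adjMatrix ℝ).IsHermitian) {a b : F} (hb : b ≠ 0)
    (hM0 : 0 ≤ (cubicSum ψ a b).re)
    (hM : ∀ c d : F, c ≠ 0 → d ≠ 0 → (cubicSum ψ c d).re ≤ (cubicSum ψ a b).re)
    (hmM : ((m : ℝ) - 1) * Fintype.card F ≤
      ((Fintype.card F : ℝ) - 1) * (cubicSum ψ a b).re) :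
    secondLargestEig hA = ((Fintype.card F : ℝ) - 1) * (cubicSum ψ a b).re := by
  have hcard : (1 : ℝ) ≤ Fintype.card F := by exact_mod_cast Fintype.card_pos (α := F)
  refine secondLargestEig_eq_of_diagonalization hA (charTable_mul_inv hψ (m + 2))
    (adjMatrix_mul_charTable ψ G hAdj) 0 (extremalVector m (a / b ^ 3)) ?_
    (eigenvalueAt_extremalVector_re ψ hm a hb) ?_ ?_
  · intro h
    exact one_ne_zero (congrFun h 1 : (1 : F) = 0)
  · rw [eigenvalueAt_zero_re]
    exact mul_le_mul_of_nonneg_left (cubicSum_re_le _ _ _) (by linarith)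
  · intro w hw
    by_cases h : w 0 = 0 ∧ w 1 = 0
    · exact (eigenvalueAt_re_le_of_head_eq_zero hψ hF (by omega) hw h.1 h.2).trans hmM
    · exact eigenvalueAt_re_le_of_head_ne_zero hψ hM0 (cubicSum_re_le _ _ _) hM h

end

/-- for odd `q ≡ 2 (mod 3)`, `4 ≤ k ≤ q`, `g_i(X) = X³`, `f_i(X) = X^{i−1}`
(for `3 ≤ i ≤ k+1`), if `k < ((q−1)/q)·M_q + 2` then `λ₂(S(k+1,q)) = λ₂(S(k,q))`. -/
theorem stmt_17 (p e q k : ℕ) (hp : p.Prime) (he : 1 ≤ e) (hq : q = p ^ e)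
    (hqodd : Odd q) (hq3 : q % 3 = 2) (hk4 : 4 ≤ k) (hkq : k ≤ q)
    (F : Type) [Field F] [Fintype F] [DecidableEq F] [Algebra (ZMod p) F]
    (hcard : Fintype.card F = q)
    (f g : Fin (k + 1) → Polynomial F)
    (hf : ∀ i : Fin (k + 1), 2 ≤ (i : ℕ) → f i = Polynomial.X ^ (i : ℕ))
    (hg : ∀ i : Fin (k + 1), 2 ≤ (i : ℕ) → g i = Polynomial.X ^ 3)
    (G : SimpleGraph (Fin k → F)) [DecidableRel G.Adj]
    (hAdj : ∀ a b : Fin k → F, G.Adj a b ↔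
      (a ⟨0, by omega⟩ ≠ b ⟨0, by omega⟩ ∧ ∀ i : Fin k, 2 ≤ (i : ℕ) →
        b i - a i = (g i.castSucc).eval (b ⟨0, by omega⟩ - a ⟨0, by omega⟩) *
          (f i.castSucc).eval
            ((b ⟨1, by omega⟩ - a ⟨1, by omega⟩) / (b ⟨0, by omega⟩ - a ⟨0, by omega⟩))))
    (G' : SimpleGraph (Fin (k + 1) → F)) [DecidableRel G'.Adj]
    (hAdj' : ∀ a b : Fin (k + 1) → F, G'.Adj a b ↔
      (a ⟨0, by omega⟩ ≠ b ⟨0, by omega⟩ ∧ ∀ i : Fin (k + 1), 2 ≤ (i : ℕ) →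
        b i - a i = (g i).eval (b ⟨0, by omega⟩ - a ⟨0, by omega⟩) *
          (f i).eval ((b ⟨1, by omega⟩ - a ⟨1, by omega⟩) / (b ⟨0, by omega⟩ - a ⟨0, by omega⟩))))
    (hA : (G.adjMatrix ℝ).IsHermitian) (hA' : (G'.adjMatrix ℝ).IsHermitian)
    (Mq : ℝ)
    (hMq : IsGreatest {r : ℝ | ∃ a b : F, a ≠ 0 ∧ b ≠ 0 ∧
      expSum p F (Polynomial.C a * Polynomial.X ^ 3 + Polynomial.C b * Polynomial.X) = (r : ℂ)}
      Mq)
    (hklt : (k : ℝ) < ((q : ℝ) - 1) / (q : ℝ) * Mq + 2) :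
    secondLargestEig hA' = secondLargestEig hA := by
  have : Fact p.Prime := ⟨hp⟩
  have hψ := traceChar_isPrimitive p F
  have hF : Fintype.card F % 3 = 2 := hcard ▸ hq3
  obtain ⟨m, rfl⟩ : ∃ m, k = m + 2 := ⟨k - 2, by omega⟩
  obtain ⟨⟨a, b, ha, hb, hab⟩, hmax⟩ := hMq
  rw [expSum_eq_cubicSum] at hab
  have hre : (cubicSum (traceChar p F) a b).re = Mq := by rw [hab, Complex.ofReal_re]
  have hM (c d : F) (hc : c ≠ 0) (hd : d ≠ 0) :
      (cubicSum (traceChar p F) c d).re ≤ (cubicSum (traceChar p F) a b).re := by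
    rw [hre]
    exact hmax ⟨c, d, hc, hd, by rw [expSum_eq_cubicSum, cubicSum_re_eq]⟩
  have hq1 : (1 : ℝ) < Fintype.card F := by exact_mod_cast Fintype.one_lt_card (α := F)
  rw [← hcard, ← hre] at hklt
  push_cast at hklt
  have hmM : (m : ℝ) * Fintype.card F ≤
      ((Fintype.card F : ℝ) - 1) * (cubicSum (traceChar p F) a b).re := by
    rw [← le_div_iff₀ (by linarith), ← div_mul_eq_mul_div]
    linarith
  have hM0 : 0 ≤ (cubicSum (traceChar p F) a b).re := by
    refine nonneg_of_mul_nonneg_right (le_trans ?_ hmM) (sub_pos.2 hq1)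
    positivity
  rw [secondLargestEig_eq_mul (m := m) hψ hF (by omega) G ?_ hA hb hM0 hM (by linarith),
    secondLargestEig_eq_mul (m := m + 1) hψ hF (by omega) G' ?_ hA' hb hM0 hM
      (by push_cast; linarith)]
  · intro x y
    refine (hAdj' x y).trans (and_congr_right fun _ => forall₂_congr fun i hi => ?_)
    rw [hf i hi, hg i hi, Polynomial.eval_pow, Polynomial.eval_pow, Polynomial.eval_X,
      Polynomial.eval_X]
    rfl
  · intro x y
    refine (hAdj x y).trans (and_congr_right fun _ => forall₂_congr fun i hi => ?_)
    rw [hf i.castSucc hi, hg i.castSucc hi, Polynomial.eval_pow, Polynomial.eval_pow,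
      Polynomial.eval_X, Polynomial.eval_X]
    rfl
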